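/- arXiv:2201.06942 — 3 statements merged into one kernel-verified Lean document; each statement's English description precedes it below -/
import Mathlib

section
/- Let d ≥ 2 be an even integer, let e be an indeterminate, and let n be a positive integer with n ≡ d+1 (mod 2d). Then the following identity of rational functions in q and e holds: Σ_{k=0}^{(n−1)/d} [3dk+1]_q · (q,e,q^{1+d}/e; q^{2d})_k (q^{1−n},q^{1+n},q^{d−1}; q^d)_k / ((q^d,e,q^{1+d}/e; q^d)_k (q^{2d−n},q^{2d+n},q^{d+2}; q^{2d})_k) · q^{dk} = 0. -/
open Finset

noncomputable section

abbrev R2 : Type := MvPolynomial (Fin 2) ℚ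
abbrev K2 : Type := FractionRing R2

/-- The variable `q` as a rational function in `ℚ(q,e)`. -/
def qv : K2 := algebraMap R2 K2 (MvPolynomial.X 0)

/-- The indeterminate `e` as a rational function in `ℚ(q,e)`. -/
def ev : K2 := algebraMap R2 K2 (MvPolynomial.X 1)

/-- The q-shifted factorial `(a; q)_k = (1-a)(1-aq)⋯(1-aq^{k-1})`. -/
def qPoch {R : Type*} [CommRing R] (a q : R) (k : ℕ) : R :=
  ∏ j ∈ Finset.range k, (1 - a * q ^ j)

/-- The q-integer `[m]_q = (1 - q^m)/(1 - q)`. -/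
def qInt {K : Type*} [Field K] (q : K) (m : ℤ) : K := (1 - q ^ m) / (1 - q)

open Polynomial in
/-- The quadratic `1 - t X + s t ^ 2`; at `X = c + s / c` it factors as
`(1 - c t) (1 - s t / c)`. -/
def wellPoisedFactor {K : Type*} [Field K] (s t : K) : K[X] := 1 - C t * X + C (s * t ^ 2)

theorem wellPoisedFactor_natDegree_le {K : Type*} [Field K] (s t : K) :
    (wellPoisedFactor s t).natDegree ≤ 1 := by
  unfold wellPoisedFactor
  compute_degree

theorem wellPoisedFactor_eval {K : Type*} [Field K] (s t : K) {c : K} (hc : c ≠ 0) :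
    (wellPoisedFactor s t).eval (c + s / c) = (1 - c * t) * (1 - s / c * t) := by
  simp only [wellPoisedFactor, Polynomial.eval_add, Polynomial.eval_sub, Polynomial.eval_one,
    Polynomial.eval_mul, Polynomial.eval_C, Polynomial.eval_X]
  field_simp
  ring

open Polynomial in
theorem exists_cleared_ratio {K : Type*} [Field K] (f : ℤ → K[X]) (hf : ∀ i, (f i).natDegree ≤ 1)
    (m k : ℕ) (hk : k ≤ 2 * m + 1) :
    ∃ G : K[X], G.natDegree ≤ m ∧
      G * ∏ j ∈ range k, f (2 * ((j : ℤ) - m)) =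
        (∏ j ∈ range m, f (2 * ((j : ℤ) - m))) * ∏ j ∈ range k, f j := by
  have hdeg : ∀ (s : Finset ℕ) (g : ℕ → ℤ), (∏ j ∈ s, f (g j)).natDegree ≤ s.card := by
    intro s g
    refine (natDegree_prod_le _ _).trans ?_
    refine (Finset.sum_le_sum fun i _ => hf (g i)).trans ?_
    simp
  rcases le_total k m with h | h
  · refine ⟨(∏ j ∈ Ico k m, f (2 * ((j : ℤ) - m))) * ∏ j ∈ range k, f j, ?_, ?_⟩
    · refine natDegree_mul_le.trans ?_
      have h1 := hdeg (Ico k m) (fun j => 2 * ((j : ℤ) - m))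
      have h2 := hdeg (range k) (fun j => (j : ℤ))
      simp only [Nat.card_Ico, card_range] at h1 h2
      omega
    · rw [← Finset.prod_range_mul_prod_Ico _ h]
      ring
  · have hinj : Function.Injective (fun i : ℕ => 2 * i) := fun x y hxy => by
      simpa using hxy
    have hsub : (range (k - m)).image (fun i => 2 * i) ⊆ range k := by
      intro x hx
      simp only [mem_image, mem_range] at hx ⊢
      obtain ⟨i, hi, rfl⟩ := hx
      omega
    refine ⟨∏ j ∈ range k \ (range (k - m)).image (fun i => 2 * i), f j, ?_, ?_⟩
    · refine (hdeg _ (fun j => (j : ℤ))).trans ?_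
      rw [card_sdiff_of_subset hsub, card_image_of_injective _ hinj]
      simp only [card_range]
      omega
    · rw [← Finset.prod_range_mul_prod_Ico _ h, ← Finset.prod_sdiff hsub,
        Finset.prod_image hinj.injOn, Finset.prod_Ico_eq_prod_range]
      have : ∏ i ∈ range (k - m), f (2 * (((m + i : ℕ) : ℤ) - m)) =
          ∏ i ∈ range (k - m), f ((2 * i : ℕ) : ℤ) := by
        refine Finset.prod_congr rfl fun i _ => ?_
        congr 1
        push_cast
        ring
      rw [this]
      ring

theorem qPoch_succ {R : Type*} [CommRing R] (x y : R) (k : ℕ) :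
    qPoch x y (k + 1) = qPoch x y k * (1 - x * y ^ k) :=
  Finset.prod_range_succ _ _

theorem qPoch_ne_zero {K : Type*} [Field K] {x y : K} (h : ∀ j : ℕ, x * y ^ j ≠ 1) (k : ℕ) :
    qPoch x y k ≠ 0 :=
  Finset.prod_ne_zero_iff.mpr fun j _ => sub_ne_zero.mpr (h j).symm

theorem qPoch_eq_zero {R : Type*} [CommRing R] {x y : R} {j k : ℕ} (hjk : j < k)
    (h : x * y ^ j = 1) : qPoch x y k = 0 :=
  Finset.prod_eq_zero (mem_range.mpr hjk) (by rw [h, sub_self])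

/-- The summand of the quadratic summation with parameters `a, b, c, e` and base `p`. -/
def quadTerm {K : Type*} [Field K] (a p e b c : K) (k : ℕ) : K :=
  (1 - a * p ^ (3 * k)) * (qPoch a (p ^ 2) k * qPoch e (p ^ 2) k * qPoch (a * p / e) (p ^ 2) k) *
    (qPoch b p k * qPoch c p k * qPoch (a * p / (b * c)) p k) /
    (qPoch p p k * qPoch e p k * qPoch (a * p / e) p k *
      (qPoch (a * p ^ 2 / b) (p ^ 2) k * qPoch (a * p ^ 2 / c) (p ^ 2) k *
        qPoch (b * c * p) (p ^ 2) k)) * p ^ k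

theorem quadTerm_comm {K : Type*} [Field K] (a p e b c : K) (k : ℕ) :
    quadTerm a p e b c k = quadTerm a p e c b k := by
  unfold quadTerm
  rw [mul_comm b c]
  ring

/-- When `c = a p ^ 2 / e` the series telescopes. -/
theorem sum_quadTerm_telescoping {K : Type*} [Field K] {a p e b : K} (N : ℕ)
    (hp0 : p ≠ 0) (ha0 : a ≠ 0) (he0 : e ≠ 0) (hb0 : b ≠ 0)
    (hp : ∀ j : ℕ, p * p ^ j ≠ 1) (he : ∀ j : ℕ, e * p ^ j ≠ 1)
    (hae : ∀ j : ℕ, a * p / e * p ^ j ≠ 1)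
    (hab : ∀ j : ℕ, a * p ^ 2 / b * (p ^ 2) ^ j ≠ 1)
    (hbc : ∀ j : ℕ, b * (a * p ^ 2 / e) * p * (p ^ 2) ^ j ≠ 1)
    (hb1 : b ≠ 1) (hbe : b * p ≠ e) (hbN : b * p ^ N = 1) :
    ∑ k ∈ range (N + 1), quadTerm a p e b (a * p ^ 2 / e) k = 0 := by
  set U : ℕ → K := fun k =>
    qPoch a (p ^ 2) k * qPoch (a * p / e) (p ^ 2) k * qPoch b p k * qPoch (e / (b * p)) p k /
      (qPoch p p k * qPoch e p k * qPoch (a * p ^ 2 / b) (p ^ 2) k *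
        qPoch (b * (a * p ^ 2 / e) * p) (p ^ 2) k) *
      ((1 - p ^ k) * (1 - e / p * p ^ k) * (1 - a / b * (p ^ k) ^ 2) *
        (1 - a * b * p / e * (p ^ k) ^ 2)) with hU
  have hratio : ∀ k, qPoch (a * p ^ 2 / e) p k * (1 - a * p / e) =
      qPoch (a * p / e) p k * (1 - a * p / e * p ^ k) := by
    intro k
    rw [← qPoch_succ, qPoch, qPoch, Finset.prod_range_succ']
    simp only [pow_zero, mul_one]
    congr 1
    refine Finset.prod_congr rfl fun j _ => ?_
    ring
  have hae1 : 1 - a * p / e ≠ 0 := sub_ne_zero.mpr (by simpa using (hae 0).symm)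
  have hconst : (1 - b) * (1 - e / (b * p)) * (1 - a * p / e) ≠ 0 := by
    refine mul_ne_zero (mul_ne_zero (sub_ne_zero.mpr hb1.symm) ?_) hae1
    rw [sub_ne_zero, ne_comm, Ne, div_eq_one_iff_eq (mul_ne_zero hb0 hp0)]
    exact hbe.symm
  have hstep : ∀ k, (1 - b) * (1 - e / (b * p)) * (1 - a * p / e) *
      quadTerm a p e b (a * p ^ 2 / e) k = U (k + 1) - U k := by
    intro k
    have hPp := qPoch_ne_zero hp k
    have hPe := qPoch_ne_zero he k
    have hPae := qPoch_ne_zero hae k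
    have hPab := qPoch_ne_zero hab k
    have hPbc := qPoch_ne_zero hbc k
    have hPe2 := qPoch_ne_zero (K := K) (x := e) (y := p ^ 2)
      (fun j => by rw [← pow_mul]; exact he _) k
    have hterm : (1 - a * p / e) * quadTerm a p e b (a * p ^ 2 / e) k =
        qPoch a (p ^ 2) k * qPoch (a * p / e) (p ^ 2) k * qPoch b p k *
          qPoch (e / (b * p)) p k /
        (qPoch p p k * qPoch e p k * qPoch (a * p ^ 2 / b) (p ^ 2) k *
          qPoch (b * (a * p ^ 2 / e) * p) (p ^ 2) k) *
        ((1 - a * (p ^ k) ^ 3) * (1 - a * p / e * p ^ k) * p ^ k) := by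
      have h1 : a * p / (b * (a * p ^ 2 / e)) = e / (b * p) := by field_simp
      have h2 : a * p ^ 2 / (a * p ^ 2 / e) = e := by field_simp
      have h3 : p ^ (3 * k) = (p ^ k) ^ 3 := by rw [← pow_mul, mul_comm]
      have h4 := hratio k
      rw [← eq_div_iff hae1] at h4
      unfold quadTerm
      rw [h1, h2, h3, h4]
      generalize qPoch (b * (a * p ^ 2 / e) * p) (p ^ 2) k = x1 at *
      generalize qPoch (a * p ^ 2 / b) (p ^ 2) k = x2 at *
      generalize qPoch (a * p / e) p k = x3 at *
      generalize qPoch (a * p / e) (p ^ 2) k = x4 at *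
      generalize 1 - a * p / e = x5 at *
      generalize 1 - a * p / e * p ^ k = x6 at *
      field_simp
    have hsucc : U (k + 1) =
        qPoch a (p ^ 2) k * qPoch (a * p / e) (p ^ 2) k * qPoch b p k *
          qPoch (e / (b * p)) p k /
        (qPoch p p k * qPoch e p k * qPoch (a * p ^ 2 / b) (p ^ 2) k *
          qPoch (b * (a * p ^ 2 / e) * p) (p ^ 2) k) *
        ((1 - a * (p ^ k) ^ 2) * (1 - a * p / e * (p ^ k) ^ 2) * (1 - b * p ^ k) *
          (1 - e / (b * p) * p ^ k)) := by
      have hsq : (p ^ 2) ^ k = (p ^ k) ^ 2 := by rw [← pow_mul, ← pow_mul, mul_comm]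
      have g1 : (1 - p * p ^ k) ≠ 0 := sub_ne_zero.mpr (hp k).symm
      have g2 : (1 - e * p ^ k) ≠ 0 := sub_ne_zero.mpr (he k).symm
      have g3 : (1 - a * p ^ 2 / b * (p ^ 2) ^ k) ≠ 0 := sub_ne_zero.mpr (hab k).symm
      have g4 : (1 - b * (a * p ^ 2 / e) * p * (p ^ 2) ^ k) ≠ 0 := sub_ne_zero.mpr (hbc k).symm
      have e1 : 1 - p ^ (k + 1) = 1 - p * p ^ k := by ring
      have e2 : 1 - e / p * p ^ (k + 1) = 1 - e * p ^ k := by field_simp; ring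
      have e3 : 1 - a / b * (p ^ (k + 1)) ^ 2 = 1 - a * p ^ 2 / b * (p ^ 2) ^ k := by
        rw [hsq]; ring
      have e4 : 1 - a * b * p / e * (p ^ (k + 1)) ^ 2 =
          1 - b * (a * p ^ 2 / e) * p * (p ^ 2) ^ k := by
        rw [hsq]; ring
      simp only [hU, qPoch_succ, e1, e2, e3, e4]
      rw [← hsq]
      generalize 1 - b * (a * p ^ 2 / e) * p * (p ^ 2) ^ k = y4 at *
      generalize 1 - a * p ^ 2 / b * (p ^ 2) ^ k = y3 at *
      generalize 1 - e * p ^ k = y2 at *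
      generalize 1 - p * p ^ k = y1 at *
      generalize 1 - a * p / e * (p ^ 2) ^ k = y5 at *
      generalize 1 - e / (b * p) * p ^ k = y6 at *
      generalize qPoch (b * (a * p ^ 2 / e) * p) (p ^ 2) k = x1 at *
      generalize qPoch (a * p ^ 2 / b) (p ^ 2) k = x2 at *
      generalize qPoch (a * p / e) (p ^ 2) k = x4 at *
      generalize qPoch (e / (b * p)) p k = x5 at *
      field_simp
    rw [mul_assoc, hterm, hsucc]
    simp only [hU]
    rw [← mul_sub, mul_left_comm]
    congr 1
    generalize p ^ k = u
    field_simp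
    ring
  refine (mul_eq_zero.mp ?_).resolve_left hconst
  rw [Finset.mul_sum, Finset.sum_congr rfl fun k _ => hstep k, Finset.sum_range_sub]
  simp only [hU]
  rw [qPoch_eq_zero (Nat.lt_succ_self N) hbN]
  simp

/-- The summation with `b = p ^ (-(2 * m + 1))` vanishes. -/
theorem sum_quadTerm_eq_zero {K : Type*} [Field K] {a p e : K}
    (hp0 : p ≠ 0) (ha0 : a ≠ 0) (he0 : e ≠ 0)
    (hp : ∀ i : ℤ, i ≠ 0 → p ^ i ≠ 1) (ha : ∀ i : ℤ, a * p ^ i ≠ 1)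
    (he : ∀ i : ℤ, e * p ^ i ≠ 1) (hae : ∀ i : ℤ, a * p ^ i ≠ e) (m : ℕ) :
    ∀ c : K, c ≠ 0 → (∀ i : ℕ, c * p ^ (2 * ((i : ℤ) - m)) ≠ 1) →
      (∀ i : ℕ, a * p ^ (2 * (i : ℤ) + 2) ≠ c) →
      ∑ k ∈ range (2 * m + 2), quadTerm a p e (p ^ (-(2 * (m : ℤ) + 1))) c k = 0 := by
  induction m using Nat.strong_induction_on with
  | _ m ih =>
  set b : K := p ^ (-(2 * (m : ℤ) + 1)) with hb
  set s : K := a * p ^ (2 * m + 2) with hs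
  have hb0 : b ≠ 0 := zpow_ne_zero _ hp0
  have hs0 : s ≠ 0 := mul_ne_zero ha0 (pow_ne_zero _ hp0)
  have hbinv : b * p ^ (2 * m + 1) = 1 := by
    rw [hb, ← zpow_natCast, ← zpow_add₀ hp0]
    simp
  let f : ℤ → Polynomial K := fun i => wellPoisedFactor s (p ^ i)
  choose! G hGdeg hG using fun k (hk : k ≤ 2 * m + 1) =>
    exists_cleared_ratio f (fun i => wellPoisedFactor_natDegree_le s (p ^ i)) m k hk
  let A : ℕ → K := fun k =>
    (1 - a * p ^ (3 * k)) *
      (qPoch a (p ^ 2) k * qPoch e (p ^ 2) k * qPoch (a * p / e) (p ^ 2) k) * qPoch b p k /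
      (qPoch p p k * qPoch e p k * qPoch (a * p / e) p k * qPoch (a * p ^ 2 / b) (p ^ 2) k) *
      p ^ k
  let Q : Polynomial K := ∑ k ∈ range (2 * m + 2), Polynomial.C (A k) * G k
  have hfeval : ∀ (c : K) (_ : c ≠ 0) (i : ℤ),
      (f i).eval (c + s / c) = (1 - c * p ^ i) * (1 - s / c * p ^ i) :=
    fun c hc i => wellPoisedFactor_eval s (p ^ i) hc
  have hQdeg : Q.natDegree ≤ m := by
    refine Polynomial.natDegree_sum_le_of_forall_le _ _ fun k hk => ?_
    refine (Polynomial.natDegree_C_mul_le _ _).trans (hGdeg k ?_)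
    have := mem_range.mp hk
    omega
  have hfne : ∀ c : K, c ≠ 0 → (∀ i : ℕ, c * p ^ (2 * ((i : ℤ) - m)) ≠ 1) →
      (∀ i : ℕ, a * p ^ (2 * (i : ℤ) + 2) ≠ c) → ∀ i : ℕ,
      (f (2 * ((i : ℤ) - m))).eval (c + s / c) ≠ 0 := by
    intro c hc h1 h2 i
    rw [hfeval c hc]
    refine mul_ne_zero (sub_ne_zero.mpr (h1 i).symm) (sub_ne_zero.mpr ?_)
    intro h
    apply h2 i
    rw [div_mul_eq_mul_div, eq_div_iff hc, one_mul] at h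
    rw [h, hs, mul_assoc, ← zpow_natCast, ← zpow_add₀ hp0]
    congr 2
    push_cast
    ring
  have hQeval : ∀ c : K, c ≠ 0 → (∀ i : ℕ, c * p ^ (2 * ((i : ℤ) - m)) ≠ 1) →
      (∀ i : ℕ, a * p ^ (2 * (i : ℤ) + 2) ≠ c) →
      Q.eval (c + s / c) = (∏ j ∈ range m, (f (2 * ((j : ℤ) - m))).eval (c + s / c)) *
        ∑ k ∈ range (2 * m + 2), quadTerm a p e b c k := by
    intro c hc h1 h2
    rw [Polynomial.eval_finsetSum, Finset.mul_sum]
    refine Finset.sum_congr rfl fun k hk => ?_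
    have hk' : k ≤ 2 * m + 1 := by
      have := mem_range.mp hk
      omega
    have hGe := congrArg (Polynomial.eval (c + s / c)) (hG k hk')
    simp only [Polynomial.eval_mul, Polynomial.eval_prod] at hGe
    have hden : ∏ j ∈ range k, (f (2 * ((j : ℤ) - m))).eval (c + s / c) ≠ 0 :=
      Finset.prod_ne_zero_iff.mpr fun j _ => hfne c hc h1 h2 j
    have hnumer : ∏ j ∈ range k, (f (j : ℤ)).eval (c + s / c) =
        qPoch c p k * qPoch (a * p / (b * c)) p k := by
      rw [qPoch, qPoch, ← Finset.prod_mul_distrib]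
      refine Finset.prod_congr rfl fun j _ => ?_
      rw [hfeval c hc, zpow_natCast]
      have : s / c = a * p / (b * c) := by
        rw [div_eq_div_iff hc (mul_ne_zero hb0 hc), hs]
        linear_combination a * p * c * hbinv
      rw [this]
    have hdenom : ∏ j ∈ range k, (f (2 * ((j : ℤ) - m))).eval (c + s / c) =
        qPoch (a * p ^ 2 / c) (p ^ 2) k * qPoch (b * c * p) (p ^ 2) k := by
      rw [qPoch, qPoch, ← Finset.prod_mul_distrib]
      refine Finset.prod_congr rfl fun j _ => ?_
      have hpow : p ^ (2 * ((j : ℤ) - m)) = b * p * (p ^ 2) ^ j := by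
        rw [hb, ← zpow_natCast, ← zpow_natCast, ← zpow_mul, ← zpow_add_one₀ hp0,
          ← zpow_add₀ hp0]
        congr 1
        push_cast
        ring
      rw [hfeval c hc, hpow, hs, mul_comm]
      congr 1
      · congr 1
        linear_combination a * p / c * p * (p ^ 2) ^ j * hbinv
      · ring
    rw [hdenom] at hden
    rw [hdenom, hnumer, ← eq_div_iff hden] at hGe
    rw [Polynomial.eval_mul, Polynomial.eval_C, hGe]
    simp only [A, quadTerm]
    ring
  have hQ : Q = 0 := by
    let pt : Option (Fin m) → K := fun o => o.elim (a * p ^ 2 / e)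
      fun i => p ^ (-(2 * ((i : ℕ) : ℤ) + 1))
    have hpt0 : ∀ o, pt o ≠ 0 := by
      rintro (_ | i)
      · exact div_ne_zero (mul_ne_zero ha0 (pow_ne_zero _ hp0)) he0
      · exact zpow_ne_zero _ hp0
    have hpt1 : ∀ o (i : ℕ), pt o * p ^ (2 * ((i : ℤ) - m)) ≠ 1 := by
      rintro (_ | i) j h
      · apply hae (2 + 2 * ((j : ℤ) - m))
        change a * p ^ 2 / e * p ^ (2 * ((j : ℤ) - m)) = 1 at h
        rw [div_mul_eq_mul_div, div_eq_one_iff_eq he0] at h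
        rw [← h, zpow_add₀ hp0, mul_assoc]
        norm_cast
      · change p ^ (-(2 * ((i : ℕ) : ℤ) + 1)) * p ^ (2 * ((j : ℤ) - m)) = 1 at h
        rw [← zpow_add₀ hp0] at h
        exact hp _ (by omega) h
    have hpt2 : ∀ o (i : ℕ), a * p ^ (2 * (i : ℤ) + 2) ≠ pt o := by
      rintro (_ | i) j h
      · apply he (2 * (j : ℤ))
        change a * p ^ (2 * (j : ℤ) + 2) = a * p ^ 2 / e at h
        rw [zpow_add₀ hp0, eq_div_iff he0, zpow_ofNat] at h
        refine mul_left_cancel₀ (mul_ne_zero ha0 (pow_ne_zero 2 hp0)) ?_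
        linear_combination h
      · apply ha (2 * (j : ℤ) + 2 + (2 * ((i : ℕ) : ℤ) + 1))
        change a * p ^ (2 * (j : ℤ) + 2) = p ^ (-(2 * ((i : ℕ) : ℤ) + 1)) at h
        rw [zpow_add₀ hp0 (2 * (j : ℤ) + 2), ← mul_assoc, h, ← zpow_add₀ hp0]
        simp
    have hmixed : ∀ i : Fin m, pt none ≠ pt (some i) ∧ pt none * pt (some i) ≠ s := by
      intro i
      change a * p ^ 2 / e ≠ p ^ (-(2 * ((i : ℕ) : ℤ) + 1)) ∧
        a * p ^ 2 / e * p ^ (-(2 * ((i : ℕ) : ℤ) + 1)) ≠ s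
      constructor
      · intro h
        apply hae (2 + (2 * ((i : ℕ) : ℤ) + 1))
        rw [div_eq_iff he0, zpow_neg, inv_mul_eq_div, eq_div_iff (zpow_ne_zero _ hp0)] at h
        rw [← h, zpow_add₀ hp0, mul_assoc]
        norm_cast
      · intro h
        apply he (2 * m + (2 * ((i : ℕ) : ℤ) + 1))
        rw [zpow_neg, ← div_eq_mul_inv, div_div,
          div_eq_iff (mul_ne_zero he0 (zpow_ne_zero _ hp0)), hs] at h
        refine mul_left_cancel₀ (mul_ne_zero ha0 (pow_ne_zero 2 hp0)) ?_
        rw [zpow_add₀ hp0, mul_one]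
        have hcast : p ^ (2 * (m : ℤ)) = p ^ (2 * m) := by norm_cast
        rw [hcast]
        linear_combination -h
    have hinj : Function.Injective fun o => pt o + s / pt o := by
      intro o o' h
      have h' : (pt o - pt o') * (pt o * pt o' - s) = 0 := by
        have hx := hpt0 o
        have hy := hpt0 o'
        simp only at h
        field_simp at h
        linear_combination h
      rcases mul_eq_zero.mp h' with h' | h' <;> rw [sub_eq_zero] at h' <;>
        rcases o with _ | i <;> rcases o' with _ | j
      · rfl
      · exact absurd h' (hmixed j).1
      · exact absurd h'.symm (hmixed i).1
      · change p ^ (-(2 * ((i : ℕ) : ℤ) + 1)) = p ^ (-(2 * ((j : ℕ) : ℤ) + 1)) at h'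
        by_contra hij
        have hij' : (i : ℕ) ≠ j := fun hh => hij (congrArg some (Fin.ext hh))
        rw [← div_eq_one_iff_eq (zpow_ne_zero _ hp0), ← zpow_sub₀ hp0] at h'
        exact hp _ (by omega) h'
      · rfl
      · exact absurd h' (hmixed j).2
      · rw [mul_comm] at h'
        exact absurd h' (hmixed i).2
      · change p ^ (-(2 * ((i : ℕ) : ℤ) + 1)) * p ^ (-(2 * ((j : ℕ) : ℤ) + 1)) = s at h'
        exfalso
        refine ha (2 * m + 2 + (2 * ((i : ℕ) : ℤ) + 1 + (2 * ((j : ℕ) : ℤ) + 1))) ?_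
        have hcast : p ^ (2 * (m : ℤ) + 2) = p ^ (2 * m + 2) := by norm_cast
        rw [zpow_add₀ hp0, ← mul_assoc, hcast, ← hs, ← h', ← zpow_add₀ hp0, ← zpow_add₀ hp0]
        convert zpow_zero p using 2
        ring
    refine Polynomial.eq_zero_of_natDegree_lt_card_of_eval_eq_zero Q hinj (fun o => ?_)
      (by simpa using Nat.lt_succ_of_le hQdeg)
    rw [hQeval _ (hpt0 o) (hpt1 o) (hpt2 o)]
    refine mul_eq_zero_of_right _ ?_
    rcases o with _ | i
    · refine sum_quadTerm_telescoping (2 * m + 1) hp0 ha0 he0 hb0 (fun j => ?_)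
        (fun j => ?_) (fun j h => ?_) (fun j h => ?_) (fun j h => ?_) ?_ (fun h => ?_) hbinv
      · rw [← pow_succ', ← zpow_natCast]
        exact hp _ (by omega)
      · exact_mod_cast he j
      · rw [div_mul_eq_mul_div, div_eq_one_iff_eq he0, mul_assoc, ← pow_succ'] at h
        exact hae (j + 1 : ℕ) (by rwa [zpow_natCast])
      · rw [div_mul_eq_mul_div, div_eq_one_iff_eq hb0, hb, ← pow_mul, mul_assoc, ← pow_add,
          zpow_neg, ← mul_eq_one_iff_eq_inv₀ (zpow_ne_zero _ hp0), mul_assoc, ← zpow_natCast,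
          ← zpow_add₀ hp0] at h
        exact ha _ h
      · apply hae (-(2 * (m : ℤ) + 1) + (3 + 2 * j : ℕ))
        rw [zpow_add₀ hp0, ← hb, zpow_natCast]
        field_simp at h
        rw [← h]
        ring
      · exact hp _ (by omega)
      · refine he (2 * m) ?_
        rw [← h, hb, ← zpow_add_one₀ hp0, ← zpow_add₀ hp0]
        convert zpow_zero p using 2
        ring
    · change ∑ k ∈ range (2 * m + 2), quadTerm a p e b (p ^ (-(2 * ((i : ℕ) : ℤ) + 1))) k = 0
      rw [← ih i i.2 b hb0 (fun j h => ?_) (fun j h => ?_)]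
      · symm
        rw [Finset.sum_congr rfl fun k _ => quadTerm_comm a p e _ b k]
        refine Finset.sum_subset (Finset.range_mono (by have := i.2; omega)) fun k _ hk => ?_
        have hzero : qPoch (p ^ (-(2 * ((i : ℕ) : ℤ) + 1))) p k = 0 := by
          refine qPoch_eq_zero (j := 2 * i + 1) (by simp at hk; omega) ?_
          rw [← zpow_natCast, ← zpow_add₀ hp0]
          simp
        unfold quadTerm
        rw [hzero]
        simp
      · rw [hb, ← zpow_add₀ hp0] at h
        exact hp _ (by omega) h
      · rw [hb, zpow_neg, ← mul_eq_one_iff_eq_inv₀ (zpow_ne_zero _ hp0), mul_assoc,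
          ← zpow_add₀ hp0] at h
        exact ha _ h
  intro c hc h1 h2
  have h := hQeval c hc h1 h2
  rw [hQ, Polynomial.eval_zero] at h
  exact (mul_eq_zero.mp h.symm).resolve_left
    (Finset.prod_ne_zero_iff.mpr fun j _ => hfne c hc h1 h2 j)

theorem qv_ne_zero : qv ≠ 0 := by
  rw [qv, Ne, FaithfulSMul.algebraMap_eq_zero_iff]
  exact MvPolynomial.X_ne_zero _

theorem ev_ne_zero : ev ≠ 0 := by
  rw [ev, Ne, FaithfulSMul.algebraMap_eq_zero_iff]
  exact MvPolynomial.X_ne_zero _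

theorem qv_pow_ne_one {n : ℕ} (hn : n ≠ 0) : qv ^ n ≠ 1 := by
  intro h
  rw [qv, ← map_pow, ← map_one (algebraMap R2 K2)] at h
  have h' := congrArg (MvPolynomial.eval (fun _ => (0 : ℚ)))
    (FaithfulSMul.algebraMap_injective R2 K2 h)
  simp [hn] at h'

theorem qv_zpow_ne_one {i : ℤ} (hi : i ≠ 0) : qv ^ i ≠ 1 := by
  obtain ⟨n, rfl | rfl⟩ := i.eq_nat_or_neg
  · rw [zpow_natCast]
    exact qv_pow_ne_one (by simpa using hi)
  · rw [zpow_neg, zpow_natCast, Ne, inv_eq_one]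
    exact qv_pow_ne_one (by simpa using hi)

theorem qv_zpow_ne_ev (i : ℤ) : qv ^ i ≠ ev := by
  intro h
  obtain ⟨n, rfl | rfl⟩ := i.eq_nat_or_neg
  · rw [zpow_natCast, qv, ev, ← map_pow] at h
    have h' := congrArg (MvPolynomial.eval ![(2 : ℚ), 0])
      (FaithfulSMul.algebraMap_injective R2 K2 h)
    simp at h'
  · rw [zpow_neg, zpow_natCast, eq_comm,
      ← mul_eq_one_iff_eq_inv₀ (pow_ne_zero _ qv_ne_zero), qv, ev,
      ← map_pow, ← map_mul, ← map_one (algebraMap R2 K2)] at h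
    have h' := congrArg (MvPolynomial.eval ![(2 : ℚ), 0])
      (FaithfulSMul.algebraMap_injective R2 K2 h)
    simp at h'

/-- For even `d ≥ 2` and `n ≡ d+1 (mod 2d)`,
`Σ_{k=0}^{(n-1)/d} [3dk+1] (q,e,q^{1+d}/e;q^{2d})_k (q^{1-n},q^{1+n},q^{d-1};q^d)_k /
((q^d,e,q^{1+d}/e;q^d)_k (q^{2d-n},q^{2d+n},q^{d+2};q^{2d})_k) q^{dk} = 0`. -/
theorem stmt10 (d : ℕ) (hd2 : 2 ≤ d) (hdeven : Even d) (n : ℕ) (hn : 0 < n)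
    (hmod : n % (2 * d) = (d + 1) % (2 * d)) :
    (∑ k ∈ Finset.range ((n - 1) / d + 1),
      qInt qv (3 * (d : ℤ) * k + 1) *
        (qPoch qv (qv ^ (2 * d)) k * qPoch ev (qv ^ (2 * d)) k *
          qPoch (qv ^ (1 + d) / ev) (qv ^ (2 * d)) k) *
        (qPoch (qv ^ (1 - (n : ℤ))) (qv ^ d) k * qPoch (qv ^ (1 + (n : ℤ))) (qv ^ d) k *
          qPoch (qv ^ (d - 1)) (qv ^ d) k) /
        (qPoch (qv ^ d) (qv ^ d) k * qPoch ev (qv ^ d) k *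
          qPoch (qv ^ (1 + d) / ev) (qv ^ d) k *
          (qPoch (qv ^ (2 * (d : ℤ) - n)) (qv ^ (2 * d)) k *
            qPoch (qv ^ (2 * (d : ℤ) + n)) (qv ^ (2 * d)) k *
            qPoch (qv ^ (d + 2)) (qv ^ (2 * d)) k)) *
        qv ^ (d * k)) = 0 := by
  obtain ⟨m, rfl⟩ : ∃ m, n = d + 1 + 2 * d * m := by
    refine ⟨n / (2 * d), ?_⟩
    have h := Nat.mod_add_div n (2 * d)
    rw [hmod, Nat.mod_eq_of_lt ?_] at h
    · exact h.symm
    · omega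
  have hq0 := qv_ne_zero
  have hp0 : qv ^ d ≠ 0 := pow_ne_zero _ hq0
  have hpz : ∀ i : ℤ, (qv ^ d) ^ i = qv ^ (d * i) := fun i => by
    rw [zpow_mul, zpow_natCast]
  have hodd : ∀ i : ℤ, 1 + d * i ≠ 0 := by
    intro i h
    obtain ⟨r, hr⟩ := hdeven
    have h2 : 1 + 2 * ((r : ℤ) * i) = 0 := by rw [← h, hr]; push_cast; ring
    omega
  have hcount : (d + 1 + 2 * d * m - 1) / d + 1 = 2 * m + 2 := by
    have : d + 1 + 2 * d * m - 1 = d * (2 * m + 1) := by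
      rw [Nat.add_right_comm, Nat.add_sub_cancel]; ring
    rw [this, Nat.mul_div_cancel_left _ (by omega)]
  have key := sum_quadTerm_eq_zero (a := qv) (p := qv ^ d) (e := ev) hp0 hq0 ev_ne_zero
    (fun i hi => by
      rw [hpz]
      exact qv_zpow_ne_one (mul_ne_zero (by omega) hi))
    (fun i => by
      rw [hpz, ← zpow_one_add₀ hq0]
      exact qv_zpow_ne_one (hodd i))
    (fun i h => by
      rw [hpz] at h
      apply qv_zpow_ne_ev (-(d * i))
      exact (zpow_neg _ _).trans ((mul_eq_one_iff_eq_inv₀ (zpow_ne_zero _ hq0)).mp h).symm)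
    (fun i => by
      rw [hpz, ← zpow_one_add₀ hq0]
      exact qv_zpow_ne_ev _)
    m (qv ^ (1 + ((d + 1 + 2 * d * m : ℕ) : ℤ))) (zpow_ne_zero _ hq0)
    (fun i => by
      rw [hpz, ← zpow_add₀ hq0]
      refine qv_zpow_ne_one (ne_of_gt ?_)
      push_cast
      have : (0 : ℤ) ≤ d * i := by positivity
      linarith)
    (fun i h => by
      rw [hpz, ← zpow_one_add₀ hq0, ← div_eq_one_iff_eq (zpow_ne_zero _ hq0),
        ← zpow_sub₀ hq0] at h
      refine qv_zpow_ne_one (fun h0 => hodd (1 + 2 * m - (2 * i + 2)) ?_) h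
      push_cast at h0
      linarith)
  rw [hcount]
  rw [← mul_zero (1 - qv)⁻¹, ← key, Finset.mul_sum]
  refine Finset.sum_congr rfl fun k _ => ?_
  have hb : (qv ^ d) ^ (-(2 * (m : ℤ) + 1)) = qv ^ (1 - ((d + 1 + 2 * d * m : ℕ) : ℤ)) := by
    rw [hpz]
    congr 1
    push_cast
    ring
  have hnat : ∀ j : ℕ, qv ^ j = qv ^ (j : ℤ) := fun j => (zpow_natCast _ _).symm
  have h1 : qv ^ (3 * (d : ℤ) * k + 1) = qv * (qv ^ d) ^ (3 * k) := by
    rw [zpow_add_one₀ hq0, ← pow_mul, hnat, mul_comm]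
    congr 2
    push_cast
    ring
  have h2 : (qv ^ d) ^ 2 = qv ^ (2 * d) := by rw [← pow_mul, mul_comm]
  have h3 : qv * qv ^ d = qv ^ (1 + d) := by ring
  have h4 : qv ^ (1 - ((d + 1 + 2 * d * m : ℕ) : ℤ)) * qv ^ (1 + ((d + 1 + 2 * d * m : ℕ) : ℤ)) =
      qv ^ 2 := by
    rw [← zpow_add₀ hq0, hnat]
    congr 1
    push_cast
    ring
  have h5 : qv ^ (1 + d) / qv ^ 2 = qv ^ (d - 1) := by
    rw [div_eq_iff (pow_ne_zero _ hq0), ← pow_add]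
    congr 1
    omega
  have h6 : ∀ j : ℤ, qv * qv ^ (2 * d) / qv ^ (1 - j) = qv ^ (2 * (d : ℤ) + j) := by
    intro j
    rw [div_eq_iff (zpow_ne_zero _ hq0), ← zpow_add₀ hq0, hnat, ← zpow_one_add₀ hq0]
    congr 1
    push_cast
    ring
  have h7 : ∀ j : ℤ, qv * qv ^ (2 * d) / qv ^ (1 + j) = qv ^ (2 * (d : ℤ) - j) := by
    intro j
    rw [← sub_neg_eq_add, h6, sub_eq_add_neg]
  have h8 : qv ^ 2 * qv ^ d = qv ^ (d + 2) := by ring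
  rw [quadTerm, qInt, h1, hb, h2, h3, h4, h5, h6, h7, h8, ← pow_mul qv d k]
  ring

end
end

section
/- Let n be a positive odd integer and let a be an indeterminate. Then (aq, q/a; q²)_{(n−1)/2} ≡ (−1)^{(n−1)/2} · (1−a^n) q^{(1−n²)/4} / ((1−a) a^{(n−1)/2}) (mod Φ_n(q)), as a congruence of rational functions in q and a. -/
open Finset

noncomputable section

/-- The indeterminate `a` as a rational function in `ℚ(q,a)`. -/
def av : K2 := algebraMap R2 K2 (MvPolynomial.X 1)

/-- The n-th cyclotomic polynomial `Φ_n(q)` viewed inside `ℚ[q,a]`. -/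
def Phi2 (n : ℕ) : R2 := Polynomial.aeval (MvPolynomial.X 0) (Polynomial.cyclotomic n ℚ)

/-- `A ≡ B (mod M)`: the polynomial `M` divides the numerator of the reduced form
of the rational function `A - B`. -/
def CongrMod2 (A B : K2) (M : R2) : Prop :=
  ∃ f g : R2, g ≠ 0 ∧ (∀ p : R2, Prime p → p ∣ g → ¬ p ∣ M) ∧
    (A - B) * algebraMap R2 K2 g = algebraMap R2 K2 M * algebraMap R2 K2 f

theorem Finset.prod_range_two_mul_add_one {M : Type*} [CommMonoid M] (f : ℕ → M) (m : ℕ) :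
    ∏ i ∈ range (2 * m + 1), f i =
      f 0 * ((∏ j ∈ range m, f (2 * j + 1)) * ∏ j ∈ range m, f (2 * j + 2)) := by
  induction m with
  | zero => simp
  | succ m ih =>
    rw [show 2 * (m + 1) + 1 = 2 * m + 1 + 1 + 1 by ring, prod_range_succ, prod_range_succ, ih,
      prod_range_succ, prod_range_succ]
    simp only [mul_assoc, mul_left_comm, mul_comm]

theorem IsPrimitiveRoot.prod_range_one_sub_mul_pow {S : Type*} [CommRing S] [IsDomain S] {n : ℕ}
    {ζ : S} (hn : 0 < n) (hζ : IsPrimitiveRoot ζ n) (x : S) :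
    ∏ i ∈ range n, (1 - x * ζ ^ i) = 1 - x ^ n := by
  classical
  have hroots : Polynomial.nthRootsFinset n (1 : S) = (range n).image (ζ ^ ·) := by
    rw [Polynomial.nthRootsFinset_def, hζ.nthRoots_eq (one_pow n)]
    ext y
    simp
  have h := hζ.pow_sub_pow_eq_prod_sub_mul 1 x hn
  rw [one_pow, hroots, prod_image] at h
  · rw [h]
    exact prod_congr rfl fun i _ => by ring
  · intro i hi j hj hij
    exact hζ.pow_inj (mem_range.1 hi) (mem_range.1 hj) hij

section CyclotomicRoot

variable {A : Type*} [CommRing A] [Algebra ℚ A] {n : ℕ} {z : A}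

theorem pow_eq_one_of_aeval_cyclotomic_eq_zero
    (hz : Polynomial.aeval z (Polynomial.cyclotomic n ℚ) = 0) : z ^ n = 1 := by
  obtain ⟨r, hr⟩ := Polynomial.cyclotomic.dvd_X_pow_sub_one n ℚ
  have h := congrArg (Polynomial.aeval z) hr
  rw [map_mul, hz, zero_mul] at h
  simpa [sub_eq_zero] using h

theorem prod_range_one_sub_mul_pow_of_aeval_cyclotomic_eq_zero (hn : 0 < n)
    (hz : Polynomial.aeval z (Polynomial.cyclotomic n ℚ) = 0) (x : A) :
    ∏ i ∈ range n, (1 - x * z ^ i) = 1 - x ^ n := by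
  have : Fact (Irreducible (Polynomial.cyclotomic n ℚ)) :=
    ⟨Polynomial.cyclotomic.irreducible_rat hn⟩
  let S := AdjoinRoot (Polynomial.cyclotomic n ℚ)
  have : NeZero n := ⟨hn.ne'⟩
  have : CharZero S := algebraRat.charZero S
  have hroot : IsPrimitiveRoot (AdjoinRoot.root (Polynomial.cyclotomic n ℚ)) n := by
    rw [← Polynomial.isRoot_cyclotomic_iff, ← Polynomial.map_cyclotomic n (algebraMap ℚ S)]
    exact AdjoinRoot.isRoot_root _
  have hX := (hroot.map_of_injective (f := Polynomial.C (R := S))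
    Polynomial.C_injective).prod_range_one_sub_mul_pow hn Polynomial.X
  let φ : S →+* A := AdjoinRoot.lift (algebraMap ℚ A) z hz
  have hφ : φ (AdjoinRoot.root _) = z := AdjoinRoot.lift_root hz
  have h := congrArg (Polynomial.eval₂RingHom φ x) hX
  simpa only [map_prod, map_sub, map_mul, map_pow, map_one, Polynomial.coe_eval₂RingHom,
    Polynomial.eval₂_X, Polynomial.eval₂_C, hφ] using h

/-- The polynomial form of the evaluation of `(xz, z/x; z²)_m` at a primitive `(2m+1)`-st root of
unity `z`. -/
theorem qPoch_mul_prod_sub_of_aeval_cyclotomic_eq_zero (m : ℕ)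
    (hz : Polynomial.aeval z (Polynomial.cyclotomic (2 * m + 1) ℚ) = 0) (x : A) :
    z ^ (m ^ 2 + m) * ((1 - x) *
        (qPoch (x * z) (z ^ 2) m * ∏ j ∈ range m, (x - z * (z ^ 2) ^ j))) =
      (-1) ^ m * (1 - x ^ (2 * m + 1)) := by
  have hz1 := pow_eq_one_of_aeval_cyclotomic_eq_zero hz
  have hodd : qPoch (x * z) (z ^ 2) m = ∏ j ∈ range m, (1 - x * z ^ (2 * j + 1)) :=
    prod_congr rfl fun j _ => by ring
  have hfactor : ∏ j ∈ range m, (x - z * (z ^ 2) ^ j) =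
      (∏ j ∈ range m, (-z ^ (2 * j + 1))) * ∏ j ∈ range m, (1 - x * z ^ (2 * j + 2)) := by
    rw [← prod_range_reflect (fun j => 1 - x * z ^ (2 * j + 2)), ← prod_mul_distrib]
    refine prod_congr rfl fun j hj => ?_
    have hj' := mem_range.1 hj
    have h : z ^ (2 * j + 1) * z ^ (2 * (m - 1 - j) + 2) = 1 := by
      rw [← pow_add, ← hz1]
      congr 1
      omega
    linear_combination (-x) * h
  have hsign : ∀ k : ℕ, ∏ j ∈ range k, (-z ^ (2 * j + 1)) = (-1) ^ k * z ^ (k ^ 2) := by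
    intro k
    induction k with
    | zero => simp
    | succ k ih => rw [prod_range_succ, ih]; ring
  have hprod := prod_range_one_sub_mul_pow_of_aeval_cyclotomic_eq_zero (by omega) hz x
  rw [prod_range_two_mul_add_one, pow_zero, mul_one] at hprod
  have hpow : z ^ (m ^ 2 + m) * z ^ m ^ 2 = 1 := by
    rw [← pow_add, show m ^ 2 + m + m ^ 2 = (2 * m + 1) * m by ring, pow_mul, hz1, one_pow]
  rw [hodd, hfactor, hsign, ← hprod]
  linear_combination (-1) ^ m * (1 - x) * (∏ j ∈ range m, (1 - x * z ^ (2 * j + 1))) *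
    (∏ j ∈ range m, (1 - x * z ^ (2 * j + 2))) * hpow

end CyclotomicRoot

theorem aeval_mk_X_zero_cyclotomic (n : ℕ) :
    Polynomial.aeval (Ideal.Quotient.mk (Ideal.span {Phi2 n}) (MvPolynomial.X 0))
      (Polynomial.cyclotomic n ℚ) = 0 := by
  have h := Polynomial.aeval_algHom_apply (Ideal.Quotient.mkₐ ℚ (Ideal.span {Phi2 n}))
    (MvPolynomial.X 0) (Polynomial.cyclotomic n ℚ)
  rw [Ideal.Quotient.mkₐ_eq_mk] at h
  rw [h]
  exact Ideal.Quotient.eq_zero_iff_mem.2 (Ideal.mem_span_singleton_self _)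

theorem not_dvd_Phi2_of_aeval_eq_zero (n : ℕ) {u : R2} (c : ℚ)
    (hu : MvPolynomial.aeval ![Polynomial.X, Polynomial.C c] u = 0) : ¬ u ∣ Phi2 n := by
  intro h
  have h' := map_dvd (MvPolynomial.aeval ![Polynomial.X, Polynomial.C c]) h
  rw [hu, zero_dvd_iff, Phi2, ← Polynomial.aeval_algHom_apply] at h'
  simp [Polynomial.cyclotomic_ne_zero] at h'

theorem prime_one_sub_X_one : Prime (1 - MvPolynomial.X 1 : R2) := by
  let σ : R2 →ₐ[ℚ] R2 := MvPolynomial.aeval ![MvPolynomial.X 0, 1 - MvPolynomial.X 1]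
  have hσ : σ.comp σ = AlgHom.id ℚ R2 := by
    ext i
    fin_cases i <;> simp [σ]
  have h := (MulEquiv.prime_iff (AlgEquiv.ofAlgHom σ σ hσ hσ)
    (p := (MvPolynomial.X 1 : R2))).2 MvPolynomial.X_prime
  simpa [σ] using h

theorem Prime.not_dvd_Phi2_of_dvd {n : ℕ} {p : R2} (hp : Prime p) {i j : ℕ}
    (h : p ∣ (1 - MvPolynomial.X 1) * MvPolynomial.X 1 ^ i * MvPolynomial.X 0 ^ j) :
    ¬ p ∣ Phi2 n := by
  intro hM
  rcases hp.dvd_or_dvd h with h | h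
  · rcases hp.dvd_or_dvd h with h | h
    · exact not_dvd_Phi2_of_aeval_eq_zero n 1 (by simp)
        ((hp.associated_of_dvd prime_one_sub_X_one h).symm.dvd.trans hM)
    · exact not_dvd_Phi2_of_aeval_eq_zero n 0 (by simp)
        ((hp.associated_of_dvd MvPolynomial.X_prime (hp.dvd_of_dvd_pow h)).symm.dvd.trans hM)
  · have hX := hp.dvd_of_dvd_pow h
    have h1 : p ∣ MvPolynomial.X 0 ^ n - 1 := by
      refine hM.trans ?_
      have := map_dvd (Polynomial.aeval (MvPolynomial.X 0 : R2))
        (Polynomial.cyclotomic.dvd_X_pow_sub_one n ℚ)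
      simpa [Phi2] using this
    rcases Nat.eq_zero_or_pos n with rfl | hn
    · exact hp.not_isUnit (isUnit_of_dvd_one (by simpa [Phi2] using hM))
    · exact hp.not_isUnit (isUnit_of_dvd_one
        ((dvd_sub_right (hX.trans (dvd_pow_self _ hn.ne'))).1 h1))

theorem qPoch_div_mul_pow {K : Type*} [Field K] {x : K} (hx : x ≠ 0) (z : K) (m : ℕ) :
    qPoch (z / x) (z ^ 2) m * x ^ m = ∏ j ∈ range m, (x - z * (z ^ 2) ^ j) := by
  rw [qPoch, ← card_range m, ← prod_const, card_range, ← prod_mul_distrib]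
  exact prod_congr rfl fun j _ => by field_simp

/-- Lemma 4.1: for odd `n > 0`,
`(aq,q/a;q²)_{(n-1)/2} ≡ (-1)^{(n-1)/2} (1-a^n) q^{(1-n²)/4} / ((1-a) a^{(n-1)/2})
(mod Φ_n(q))`. -/
theorem stmt14 (n : ℕ) (hn : 0 < n) (hodd : Odd n) :
    CongrMod2
      (qPoch (av * qv) (qv ^ 2) ((n - 1) / 2) * qPoch (qv / av) (qv ^ 2) ((n - 1) / 2))
      ((-1 : K2) ^ ((n - 1) / 2) * (1 - av ^ n) * qv ^ ((1 - (n : ℤ) ^ 2) / 4) /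
        ((1 - av) * av ^ ((n - 1) / 2)))
      (Phi2 n) := by
  obtain ⟨m, rfl⟩ := hodd
  have hexp : (1 - ((2 * m + 1 : ℕ) : ℤ) ^ 2) / 4 = -((m ^ 2 + m : ℕ) : ℤ) := by
    rw [show 1 - ((2 * m + 1 : ℕ) : ℤ) ^ 2 = -((m ^ 2 + m : ℕ) : ℤ) * 4 by push_cast; ring]
    exact Int.mul_ediv_cancel _ (by norm_num)
  rw [hexp, show (2 * m + 1 - 1) / 2 = m by omega, zpow_neg, zpow_natCast]
  have hinj : Function.Injective (algebraMap R2 K2) := IsFractionRing.injective R2 K2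
  have hq : qv ≠ 0 := (map_ne_zero_iff _ hinj).2 (MvPolynomial.X_ne_zero 0)
  have ha : av ≠ 0 := (map_ne_zero_iff _ hinj).2 (MvPolynomial.X_ne_zero 1)
  have ha1 : 1 - av ≠ 0 := by
    simpa [av] using (map_ne_zero_iff _ hinj).2 prime_one_sub_X_one.ne_zero
  have hdvd : Phi2 (2 * m + 1) ∣
      MvPolynomial.X 0 ^ (m ^ 2 + m) * ((1 - MvPolynomial.X 1) *
        (qPoch (MvPolynomial.X 1 * MvPolynomial.X 0) (MvPolynomial.X 0 ^ 2) m *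
          ∏ j ∈ range m, (MvPolynomial.X 1 - MvPolynomial.X 0 * (MvPolynomial.X 0 ^ 2) ^ j))) -
      (-1) ^ m * (1 - MvPolynomial.X 1 ^ (2 * m + 1)) := by
    rw [← Ideal.mem_span_singleton, ← Ideal.Quotient.eq_zero_iff_mem]
    have h := qPoch_mul_prod_sub_of_aeval_cyclotomic_eq_zero m
      (aeval_mk_X_zero_cyclotomic (2 * m + 1))
      (Ideal.Quotient.mk (Ideal.span {Phi2 (2 * m + 1)}) (MvPolynomial.X 1))
    simpa only [qPoch, map_sub, map_mul, map_pow, map_prod, map_one, map_neg, sub_eq_zero] using h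
  obtain ⟨f, hf⟩ := hdvd
  refine ⟨f, (1 - MvPolynomial.X 1) * MvPolynomial.X 1 ^ m * MvPolynomial.X 0 ^ (m ^ 2 + m),
    mul_ne_zero (mul_ne_zero prime_one_sub_X_one.ne_zero
      (pow_ne_zero _ (MvPolynomial.X_ne_zero 1))) (pow_ne_zero _ (MvPolynomial.X_ne_zero 0)),
    fun p hp h => hp.not_dvd_Phi2_of_dvd h, ?_⟩
  rw [← map_mul, ← hf]
  simp only [qPoch, map_sub, map_mul, map_pow, map_prod, map_one, map_neg]
  change (qPoch (av * qv) (qv ^ 2) m * qPoch (qv / av) (qv ^ 2) m - _) *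
      ((1 - av) * av ^ m * qv ^ (m ^ 2 + m)) =
    qv ^ (m ^ 2 + m) * ((1 - av) * (qPoch (av * qv) (qv ^ 2) m *
      ∏ j ∈ range m, (av - qv * (qv ^ 2) ^ j))) - (-1) ^ m * (1 - av ^ (2 * m + 1))
  rw [← qPoch_div_mul_pow ha]
  field_simp

end
end

section
/- Let n be a positive integer with n ≡ 1 (mod 4) and let a be an indeterminate. Then (aq, q/a; q²)_{(n+1)/2} / (aq², q²/a; q^4)_{(n+1)/2} ≡ q^{(n²−1)/4} (mod Φ_n(q)), as a congruence of rational functions in q and a. -/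
open Finset

noncomputable section

/-- The product `∏_{j<m} (1 - a q^{2j+1}) (a - q^{2j+1})`, which is
`a^m (aq, q/a; q²)_m` cleared of denominators. -/
def oddProd {R : Type*} [CommRing R] (a q : R) (m : ℕ) : R :=
  ∏ j ∈ range m, (1 - a * q ^ (2 * j + 1)) * (a - q ^ (2 * j + 1))

lemma map_oddProd {R S : Type*} [CommRing R] [CommRing S] (φ : R →+* S) (a q : R) (m : ℕ) :
    φ (oddProd a q m) = oddProd (φ a) (φ q) m := by
  simp [oddProd, map_prod]

lemma qPoch_mul_qPoch_mul_pow {K : Type*} [Field K] {a : K} (ha : a ≠ 0) (q : K) (m : ℕ) :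
    qPoch (a * q) (q ^ 2) m * qPoch (q / a) (q ^ 2) m * a ^ m = oddProd a q m := by
  have hpow : a ^ m = ∏ _j ∈ range m, a := by simp
  rw [hpow, qPoch, qPoch, oddProd, ← prod_mul_distrib, ← prod_mul_distrib]
  refine prod_congr rfl fun j _ => ?_
  field_simp
  ring

lemma prod_range_two_mul {M : Type*} [CommMonoid M] (f : ℕ → M) (m : ℕ) :
    ∏ r ∈ range (2 * m), f r = ∏ j ∈ range m, f (2 * j) * f (2 * j + 1) := by
  induction m with
  | zero => simp
  | succ m ih => rw [mul_add, mul_one, prod_range_succ, prod_range_succ, prod_range_succ, ih,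
      mul_assoc]

lemma prod_range_odd_pow {R : Type*} [CommRing R] (q : R) (m : ℕ) :
    ∏ j ∈ range m, q ^ (2 * j + 1) = q ^ m ^ 2 := by
  induction m with
  | zero => simp
  | succ m ih => rw [prod_range_succ, ih, ← pow_add]; ring_nf

/-- If `q ^ (2m-1) = 1`, then `oddProd a q m` is up to a monomial a product over all residues. -/
lemma oddProd_eq_of_pow_eq_one {R : Type*} [CommRing R] (a : R) {q : R} {m : ℕ}
    (hq : q ^ (2 * m - 1) = 1) :
    oddProd a q m = (-1) ^ m * q ^ m ^ 2 * ∏ r ∈ range (2 * m), (1 - a * q ^ r) := by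
  have hfactor : ∀ j ∈ range m, a - q ^ (2 * j + 1) =
      -1 * q ^ (2 * j + 1) * (1 - a * q ^ (2 * (m - 1 - j))) := by
    intro j hj
    have hj := mem_range.mp hj
    have hmul : q ^ (2 * j + 1) * q ^ (2 * (m - 1 - j)) = 1 := by
      rw [← pow_add, ← hq]
      congr 1
      omega
    linear_combination (-a) * hmul
  rw [oddProd, prod_mul_distrib, prod_congr rfl hfactor, prod_mul_distrib, prod_mul_distrib,
    prod_range_odd_pow, prod_range_reflect (fun j => 1 - a * q ^ (2 * j)) m,
    prod_range_two_mul, prod_mul_distrib]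
  simp only [prod_const, card_range]
  ring

/-- Squaring permutes the powers of `q` when `q` has odd order. -/
lemma prod_range_sq_of_pow_eq_one {R : Type*} [CommRing R] (a : R) {q : R} {m : ℕ}
    (hm : 0 < m) (hq : q ^ (2 * m - 1) = 1) :
    ∏ r ∈ range (2 * m), (1 - a * (q ^ 2) ^ r) = ∏ r ∈ range (2 * m), (1 - a * q ^ r) := by
  rw [prod_range_two_mul (fun r => 1 - a * q ^ r), prod_mul_distrib, two_mul m, prod_range_add]
  congr 1
  · exact prod_congr rfl fun j _ => by rw [pow_mul]
  · refine prod_congr rfl fun j _ => ?_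
    have hexp : 2 * (m + j) = (2 * m - 1) + (2 * j + 1) := by omega
    rw [← pow_mul, hexp, pow_add, hq, one_mul]

lemma oddProd_eq_pow_mul_oddProd_sq {R : Type*} [CommRing R] (a : R) {q : R} {m : ℕ}
    (hm : 0 < m) (hq : q ^ (2 * m - 1) = 1) :
    oddProd a q m = q ^ (m * (m - 1)) * oddProd a (q ^ 2) m := by
  have hq2 : (q ^ 2) ^ (2 * m - 1) = 1 := by rw [← pow_mul, mul_comm, pow_mul, hq, one_pow]
  have hexp : m * (m - 1) + 2 * m ^ 2 = m ^ 2 + (2 * m - 1) * m := by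
    obtain ⟨k, rfl⟩ : ∃ k, m = k + 1 := ⟨m - 1, by omega⟩
    have h : 2 * (k + 1) - 1 = 2 * k + 1 := by omega
    rw [h, Nat.add_sub_cancel]
    ring
  have hpow : q ^ (m * (m - 1)) * q ^ (2 * m ^ 2) = q ^ m ^ 2 := by
    rw [← pow_add, hexp, pow_add, pow_mul, hq, one_pow, mul_one]
  rw [oddProd_eq_of_pow_eq_one a hq, oddProd_eq_of_pow_eq_one a hq2,
    prod_range_sq_of_pow_eq_one a hm hq, ← pow_mul, ← hpow]
  ring

lemma pow_sub_one_dvd_oddProd_sub {R : Type*} [CommRing R] (a q : R) {m : ℕ} (hm : 0 < m) :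
    q ^ (2 * m - 1) - 1 ∣ oddProd a q m - q ^ (m * (m - 1)) * oddProd a (q ^ 2) m := by
  rw [← Ideal.mem_span_singleton, ← Ideal.Quotient.eq_zero_iff_mem]
  set π := Ideal.Quotient.mk (Ideal.span {q ^ (2 * m - 1) - 1})
  have hq : π q ^ (2 * m - 1) = 1 := by
    rw [← sub_eq_zero, ← map_pow, ← map_one π, ← map_sub, Ideal.Quotient.eq_zero_iff_mem]
    exact Ideal.mem_span_singleton_self _
  rw [map_sub, map_mul, map_oddProd, map_oddProd, map_pow, map_pow, sub_eq_zero]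
  exact oddProd_eq_pow_mul_oddProd_sq _ hm hq

lemma Phi2_dvd (n : ℕ) : Phi2 n ∣ (MvPolynomial.X 0 : R2) ^ n - 1 := by
  simpa [Phi2] using map_dvd (Polynomial.aeval (MvPolynomial.X 0 : R2))
    (Polynomial.cyclotomic.dvd_X_pow_sub_one n ℚ)

lemma X_pow_sub_one_ne_zero (i : Fin 2) {n : ℕ} (hn : 0 < n) :
    (MvPolynomial.X i : R2) ^ n - 1 ≠ 0 := by
  intro h
  simpa [hn.ne'] using congrArg (MvPolynomial.eval fun _ => (0 : ℚ)) h

lemma degreeOf_eq_zero_of_dvd {i j : Fin 2} (hij : i ≠ j) {n : ℕ} (hn : 0 < n) {p : R2}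
    (hp : p ∣ MvPolynomial.X j ^ n - 1) : p.degreeOf i = 0 := by
  obtain ⟨r, hr⟩ := hp
  have hne : p * r ≠ 0 := hr ▸ X_pow_sub_one_ne_zero j hn
  have hmul := MvPolynomial.degreeOf_mul_eq (n := i) (left_ne_zero_of_mul hne)
    (right_ne_zero_of_mul hne)
  have hle := MvPolynomial.degreeOf_sub_le i ((MvPolynomial.X j : R2) ^ n) 1
  rw [MvPolynomial.degreeOf_X_pow_of_ne n hij, MvPolynomial.degreeOf_one, hr] at hle
  simp only [max_self] at hle
  omega

/-- The polynomials `q^n - 1` and `a^n - 1` have no common prime factor. -/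
lemma not_dvd_of_prime {n : ℕ} (hn : 0 < n) {p : R2} (hp : Prime p)
    (h0 : p ∣ MvPolynomial.X 0 ^ n - 1) : ¬ p ∣ MvPolynomial.X 1 ^ n - 1 := by
  intro h1
  have hdeg : p.totalDegree = 0 := by
    rw [MvPolynomial.totalDegree_eq_zero_iff]
    intro d hd i
    have hle := MvPolynomial.monomial_le_degreeOf i hd
    have hzero : p.degreeOf i = 0 := by
      fin_cases i
      · exact degreeOf_eq_zero_of_dvd (by decide) hn h1
      · exact degreeOf_eq_zero_of_dvd (by decide) hn h0
    omega
  rw [MvPolynomial.totalDegree_eq_zero_iff_eq_C] at hdeg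
  refine hp.not_isUnit ?_
  rw [hdeg]
  refine IsUnit.map MvPolynomial.C (isUnit_iff_ne_zero.mpr fun hc => hp.ne_zero ?_)
  rw [hdeg, hc, map_zero]

/-- A common divisor of `q^n - 1` and of `1 - a q^k` or `a - q^k` divides `a^n - 1`. -/
lemma dvd_pow_sub_one_of_dvd_factor {R : Type*} [CommRing R] {p a q : R} {n : ℕ} (k : ℕ)
    (hq : p ∣ q ^ n - 1) (h : p ∣ 1 - a * q ^ k ∨ p ∣ a - q ^ k) : p ∣ a ^ n - 1 := by
  have hqk : p ∣ (q ^ k) ^ n - 1 := by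
    rw [← pow_mul, mul_comm, pow_mul]
    exact hq.trans (by simpa using sub_dvd_pow_sub_pow (q ^ n) 1 k)
  rcases h with h | h
  · have hpow : p ∣ 1 - (a * q ^ k) ^ n :=
      h.trans (by simpa using sub_dvd_pow_sub_pow 1 (a * q ^ k) n)
    have heq : a ^ n - 1 = -(1 - (a * q ^ k) ^ n) - a ^ n * ((q ^ k) ^ n - 1) := by ring
    rw [heq]
    exact dvd_sub (hpow.neg_right) (hqk.mul_left _)
  · have hpow : p ∣ a ^ n - (q ^ k) ^ n := h.trans (sub_dvd_pow_sub_pow _ _ n)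
    simpa using dvd_add hpow hqk

lemma exists_dvd_of_prime_dvd_oddProd {R : Type*} [CommRing R] {p a q : R} {m : ℕ}
    (hp : Prime p) (h : p ∣ oddProd a q m) :
    ∃ k, p ∣ 1 - a * q ^ k ∨ p ∣ a - q ^ k := by
  obtain ⟨j, -, hj⟩ := (hp.dvd_finsetProd_iff _).mp h
  exact ⟨2 * j + 1, hp.dvd_or_dvd hj⟩

/-- For `n ≡ 1 (mod 4)`,
`(aq,q/a;q²)_{(n+1)/2} / (aq²,q²/a;q⁴)_{(n+1)/2} ≡ q^{(n²-1)/4} (mod Φ_n(q))`. -/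
theorem stmt17 (n : ℕ) (hn : 0 < n) (hmod : n % 4 = 1) :
    CongrMod2
      (qPoch (av * qv) (qv ^ 2) ((n + 1) / 2) * qPoch (qv / av) (qv ^ 2) ((n + 1) / 2) /
        (qPoch (av * qv ^ 2) (qv ^ 4) ((n + 1) / 2) * qPoch (qv ^ 2 / av) (qv ^ 4) ((n + 1) / 2)))
      (qv ^ ((n ^ 2 - 1) / 4))
      (Phi2 n) := by
  obtain ⟨m, hm, rfl⟩ : ∃ m, 0 < m ∧ n = 2 * m - 1 := ⟨(n + 1) / 2, by omega, by omega⟩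
  have hm2 : (2 * m - 1 + 1) / 2 = m := by omega
  have hexp : ((2 * m - 1) ^ 2 - 1) / 4 = m * (m - 1) := by
    obtain ⟨k, rfl⟩ : ∃ k, m = k + 1 := ⟨m - 1, by omega⟩
    have hk : 2 * (k + 1) - 1 = 2 * k + 1 := by omega
    have hsq : (2 * k + 1) ^ 2 = 4 * ((k + 1) * k) + 1 := by ring
    rw [hk, hsq, Nat.add_sub_cancel, Nat.add_sub_cancel, Nat.mul_div_cancel_left _ (by norm_num)]
  rw [hm2, hexp]
  set D : R2 := oddProd (MvPolynomial.X 1) (MvPolynomial.X 0 ^ 2) m with hD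
  have hD0 : D ≠ 0 := by
    intro h
    have heval := congrArg (MvPolynomial.eval ![(0 : ℚ), 1]) h
    rw [hD, map_oddProd] at heval
    simp [oddProd] at heval
  obtain ⟨f, hf⟩ := (Phi2_dvd _).trans
    (pow_sub_one_dvd_oddProd_sub (MvPolynomial.X 1 : R2) (MvPolynomial.X 0) hm)
  refine ⟨f, D, hD0, fun p hp hpD hpM => ?_, ?_⟩
  · have hpq := hpM.trans (Phi2_dvd _)
    obtain ⟨k, hk⟩ := exists_dvd_of_prime_dvd_oddProd hp hpD
    simp only [← pow_mul] at hk
    exact not_dvd_of_prime hn hp hpq (dvd_pow_sub_one_of_dvd_factor _ hpq hk)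
  · have hinj := IsFractionRing.injective R2 K2
    have ha : av ≠ 0 := by simp [av]
    have hmapD : algebraMap R2 K2 D = oddProd av (qv ^ 2) m := by
      rw [hD, map_oddProd, map_pow]; rfl
    have hmapD0 : oddProd av (qv ^ 2) m ≠ 0 := hmapD ▸ (map_ne_zero_iff _ hinj).mpr hD0
    have hnum := qPoch_mul_qPoch_mul_pow ha qv m
    have hden := qPoch_mul_qPoch_mul_pow ha (qv ^ 2) m
    rw [← pow_mul, show 2 * 2 = 4 from rfl] at hden
    rw [← map_mul, ← hf, ← hD, map_sub, map_mul, hmapD, map_oddProd, map_pow]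
    change _ = oddProd av qv m - qv ^ (m * (m - 1)) * oddProd av (qv ^ 2) m
    rw [sub_mul, ← mul_div_mul_right _ _ (pow_ne_zero m ha), hnum, hden,
      div_mul_cancel₀ _ hmapD0]

end
end
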